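/- Every irreducible ternary cubic over ℂ whose associated projective plane curve has a singular point is linearly equivalent to exactly one of the two normal forms q² = p³ (cuspidal) or q² = p²(p+1) (nodal), given in inhomogeneous coordinates; equivalently, the homogeneous cubics zq² = p³ ... i.e., y²z = x³ and y²z = x²(x+z) represent the two GL(3,ℂ)-orbits of irreducible singular cubics. -/

import Mathlib

open MvPolynomial

/-- Two functions on `ℂ³` are equivalent if they differ by an invertible linear substitution. -/
def LinearlyEquivalent (f g : (Fin 3 → ℂ) → ℂ) : Prop :=
  ∃ A : Matrix (Fin 3) (Fin 3) ℂ, A.det ≠ 0 ∧ ∀ v, f v = g (A.mulVec v)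

theorem LinearlyEquivalent.symm {f g : (Fin 3 → ℂ) → ℂ} (h : LinearlyEquivalent f g) :
    LinearlyEquivalent g f := by
  obtain ⟨A, hA, h⟩ := h
  refine ⟨A⁻¹, ?_, fun v => ?_⟩
  · rw [Matrix.det_nonsing_inv]
    simpa using hA
  · rw [h, Matrix.mulVec_mulVec, Matrix.mul_nonsing_inv _ (isUnit_iff_ne_zero.2 hA),
      Matrix.one_mulVec]

theorem LinearlyEquivalent.trans {f g k : (Fin 3 → ℂ) → ℂ} (h : LinearlyEquivalent f g)
    (h' : LinearlyEquivalent g k) : LinearlyEquivalent f k := by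
  obtain ⟨A, hA, h⟩ := h
  obtain ⟨B, hB, h'⟩ := h'
  refine ⟨B * A, ?_, fun v => ?_⟩
  · rw [Matrix.det_mul]
    exact mul_ne_zero hB hA
  · rw [h, h', Matrix.mulVec_mulVec]

/-- The linear substitution `v ↦ A v` in a polynomial. -/
noncomputable def linearSubst (A : Matrix (Fin 3) (Fin 3) ℂ) :
    MvPolynomial (Fin 3) ℂ →ₐ[ℂ] MvPolynomial (Fin 3) ℂ :=
  bind₁ fun i => ∑ j, C (A i j) * X j

theorem eval_linearSubst (A : Matrix (Fin 3) (Fin 3) ℂ) (P : MvPolynomial (Fin 3) ℂ)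
    (v : Fin 3 → ℂ) : eval v (linearSubst A P) = eval (A.mulVec v) P := by
  rw [linearSubst, ← coe_aeval_eq_eval, ← coe_aeval_eq_eval, RingHom.coe_coe, RingHom.coe_coe,
    aeval_bind₁]
  congr 2
  ext i
  simp [Matrix.mulVec, dotProduct]

theorem isHomogeneous_linearSubst (A : Matrix (Fin 3) (Fin 3) ℂ) {P : MvPolynomial (Fin 3) ℂ}
    {n : ℕ} (h : P.IsHomogeneous n) : (linearSubst A P).IsHomogeneous n := by
  have := h.aeval (fun i => ∑ j, C (A i j) * (X j : MvPolynomial (Fin 3) ℂ)) (n := 1) fun i =>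
    IsHomogeneous.sum _ _ _ fun j _ => by
      simpa using (isHomogeneous_C (Fin 3) (A i j)).mul (isHomogeneous_X ℂ j)
  simpa [linearSubst] using this

theorem pderiv_linearSubst (A : Matrix (Fin 3) (Fin 3) ℂ) (P : MvPolynomial (Fin 3) ℂ)
    (i : Fin 3) :
    pderiv i (linearSubst A P) = ∑ j, C (A j i) * linearSubst A (pderiv j P) := by
  induction P using MvPolynomial.induction_on with
  | C a => simp [linearSubst]
  | add p q hp hq => simp [hp, hq, mul_add, Finset.sum_add_distrib]
  | mul_X p k hp =>
    have hX : linearSubst A (X k) = ∑ j, C (A k j) * X j := by simp [linearSubst]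
    have hd : pderiv i (linearSubst A (X k)) = C (A k i) := by
      simp [hX, pderiv_X, Pi.single_apply]
    simp only [map_mul, Derivation.leibniz, smul_eq_mul, hp, hd, map_add, pderiv_X, mul_add,
      Finset.sum_add_distrib]
    congr 1
    · simp [Pi.single_apply, mul_comm]
    · rw [Finset.mul_sum]
      exact Finset.sum_congr rfl fun _ _ => by ring

/-- `f` is not the product of two polynomial functions vanishing at the origin. -/
def NoFactorization (f : (Fin 3 → ℂ) → ℂ) : Prop :=
  ∀ p q : MvPolynomial (Fin 3) ℂ, eval 0 p = 0 → eval 0 q = 0 → ¬ ∀ v, f v = eval v p * eval v q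

theorem Irreducible.noFactorization {F : MvPolynomial (Fin 3) ℂ} (hF : Irreducible F) :
    NoFactorization fun v => eval v F := by
  intro p q hp hq h
  have hFpq : F = p * q := MvPolynomial.funext fun v => by simp [h v]
  rcases hF.isUnit_or_isUnit hFpq with hu | hu
  · exact (hu.map (eval 0)).ne_zero hp
  · exact (hu.map (eval 0)).ne_zero hq

theorem NoFactorization.of_linearlyEquivalent {f g : (Fin 3 → ℂ) → ℂ} (hf : NoFactorization f)
    (h : LinearlyEquivalent f g) : NoFactorization g := by
  obtain ⟨A, -, h⟩ := h
  intro p q hp hq hg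
  refine hf (linearSubst A p) (linearSubst A q) ?_ ?_ fun v => ?_
  · rw [eval_linearSubst, Matrix.mulVec_zero, hp]
  · rw [eval_linearSubst, Matrix.mulVec_zero, hq]
  · rw [h, hg, eval_linearSubst, eval_linearSubst]

theorem exists_mulVec_eq {v : Fin 3 → ℂ} (hv : v ≠ 0) :
    ∃ B : Matrix (Fin 3) (Fin 3) ℂ, B.det ≠ 0 ∧ B.mulVec ![0, 0, 1] = v := by
  by_cases h0 : v 0 = 0
  · by_cases h1 : v 1 = 0
    · have h2 : v 2 ≠ 0 := fun h2 => hv (by ext i; fin_cases i <;> simp [h0, h1, h2])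
      refine ⟨!![1, 0, v 0; 0, 1, v 1; 0, 0, v 2], by simpa [Matrix.det_fin_three] using h2, ?_⟩
      ext i
      fin_cases i <;> simp
    · refine ⟨!![1, 0, v 0; 0, 0, v 1; 0, 1, v 2], by simpa [Matrix.det_fin_three] using h1, ?_⟩
      ext i
      fin_cases i <;> simp
  · refine ⟨!![0, 0, v 0; 1, 0, v 1; 0, 1, v 2], by simpa [Matrix.det_fin_three] using h0, ?_⟩
    ext i
    fin_cases i <;> simp

theorem sum_antidiagonalTuple_three (w : (Fin 3 → ℕ) → ℂ) :
    ∑ d ∈ Finset.Nat.antidiagonalTuple 3 3, w d =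
      w ![3, 0, 0] + w ![2, 1, 0] + w ![1, 2, 0] + w ![0, 3, 0] + w ![2, 0, 1] + w ![1, 1, 1] +
        w ![0, 2, 1] + w ![1, 0, 2] + w ![0, 1, 2] + w ![0, 0, 3] := by
  have : Finset.Nat.antidiagonalTuple 3 3 =
    {![3, 0, 0], ![2, 1, 0], ![1, 2, 0], ![0, 3, 0], ![2, 0, 1], ![1, 1, 1], ![0, 2, 1],
      ![1, 0, 2], ![0, 1, 2], ![0, 0, 3]} := by decide
  rw [this]
  repeat rw [Finset.sum_insert (by decide)]
  rw [Finset.sum_singleton]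
  ring

/-- A ternary cubic written out in its ten coefficients. -/
theorem MvPolynomial.IsHomogeneous.exists_eq_ternary_cubic {P : MvPolynomial (Fin 3) ℂ}
    (hP : P.IsHomogeneous 3) :
    ∃ a b c d α β γ l m n : ℂ,
      P = C a * X 0 ^ 3 + C b * (X 0 ^ 2 * X 1) + C c * (X 0 * X 1 ^ 2) + C d * X 1 ^ 3 +
        C α * (X 0 ^ 2 * X 2) + C β * (X 0 * X 1 * X 2) + C γ * (X 1 ^ 2 * X 2) +
        C l * (X 0 * X 2 ^ 2) + C m * (X 1 * X 2 ^ 2) + C n * X 2 ^ 3 := by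
  let e : (Fin 3 → ℕ) ≃ (Fin 3 →₀ ℕ) := Finsupp.equivFunOnFinite.symm
  let k : (Fin 3 → ℕ) → ℂ := fun d => coeff (e d) P
  refine ⟨k ![3, 0, 0], k ![2, 1, 0], k ![1, 2, 0], k ![0, 3, 0], k ![2, 0, 1], k ![1, 1, 1],
    k ![0, 2, 1], k ![1, 0, 2], k ![0, 1, 2], k ![0, 0, 3], MvPolynomial.funext fun v => ?_⟩
  have hsub : P.support ⊆ (Finset.Nat.antidiagonalTuple 3 3).map e.toEmbedding := by
    intro d hd
    rw [Finset.mem_map]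
    refine ⟨d, ?_, by ext i; simp [e]⟩
    rw [Finset.Nat.mem_antidiagonalTuple, ← Finsupp.degree_eq_sum]
    rw [Finsupp.degree_eq_weight_one]
    exact hP (mem_support_iff.1 hd)
  rw [eval_eq', Finset.sum_subset hsub, Finset.sum_map, sum_antidiagonalTuple_three]
  · have he (t : Fin 3 → ℕ) (i : Fin 3) : e t i = t i := rfl
    simp [Fin.prod_univ_three, k, he]
  · intro d _ hd
    rw [notMem_support_iff.1 hd, zero_mul]

theorem exists_linearlyEquivalent_of_singular {F : MvPolynomial (Fin 3) ℂ}
    (hhom : F.IsHomogeneous 3)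
    (hsing : ∃ v : Fin 3 → ℂ, v ≠ 0 ∧ eval v F = 0 ∧ ∀ i : Fin 3, eval v (pderiv i F) = 0) :
    ∃ a b c d α β γ : ℂ, LinearlyEquivalent (fun v => eval v F) fun v =>
      v 2 * (α * v 0 ^ 2 + β * v 0 * v 1 + γ * v 1 ^ 2) +
        (a * v 0 ^ 3 + b * v 0 ^ 2 * v 1 + c * v 0 * v 1 ^ 2 + d * v 1 ^ 3) := by
  obtain ⟨v, hv, hF, hdF⟩ := hsing
  obtain ⟨B, hB, hBv⟩ := exists_mulVec_eq hv
  obtain ⟨a, b, c, d, α, β, γ, l, m, n, h⟩ :=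
    (isHomogeneous_linearSubst B hhom).exists_eq_ternary_cubic
  have hd (i : Fin 3) : eval ![0, 0, 1] (pderiv i (linearSubst B F)) = 0 := by
    simp [pderiv_linearSubst, eval_linearSubst, hBv, hdF]
  have hn : n = 0 := by
    have h0 : eval ![0, 0, 1] (linearSubst B F) = 0 := by rw [eval_linearSubst, hBv, hF]
    simpa [h] using h0
  have hl : l = 0 := by
    simpa [h, pderiv_X, Pi.single_apply, Derivation.leibniz_pow] using hd 0
  have hm : m = 0 := by
    simpa [h, pderiv_X, Pi.single_apply, Derivation.leibniz_pow] using hd 1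
  refine ⟨a, b, c, d, α, β, γ, LinearlyEquivalent.symm ⟨B, hB, fun w => ?_⟩⟩
  beta_reduce
  rw [← eval_linearSubst, h, hl, hm, hn]
  simp
  ring

theorem exists_cubic_root {a : ℂ} (ha : a ≠ 0) (b c d : ℂ) :
    ∃ t : ℂ, a * t ^ 3 + b * t ^ 2 + c * t + d = 0 := by
  obtain ⟨t, ht⟩ := IsAlgClosed.exists_root (Cubic.toPoly ⟨a, b, c, d⟩)
    (by rw [Cubic.degree_of_a_ne_zero ha]; decide)
  exact ⟨t, by simpa [Cubic.toPoly] using ht⟩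

theorem not_noFactorization_binary_cubic (a b c d : ℂ) :
    ¬ NoFactorization fun v =>
      a * v 0 ^ 3 + b * v 0 ^ 2 * v 1 + c * v 0 * v 1 ^ 2 + d * v 1 ^ 3 := by
  intro h
  by_cases ha : a = 0
  · refine h (X 1) (C b * X 0 ^ 2 + C c * X 0 * X 1 + C d * X 1 ^ 2) (by simp) (by simp)
      fun v => ?_
    simp [ha]
    ring
  · obtain ⟨t, ht⟩ := exists_cubic_root ha b c d
    refine h (X 0 - C t * X 1) (C a * X 0 ^ 2 + C (b + a * t) * X 0 * X 1 +
      C (c + b * t + a * t ^ 2) * X 1 ^ 2) (by simp) (by simp) fun v => ?_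
    simp
    linear_combination v 1 ^ 3 * ht

theorem exists_binary_quadratic_factorization (α β γ : ℂ) :
    ∃ p q r s : ℂ, α = p * r ∧ β = p * s + q * r ∧ γ = q * s := by
  by_cases hα : α = 0
  · exact ⟨0, 1, β, γ, by simp [hα], by simp, by simp⟩
  · obtain ⟨t, ht⟩ := exists_quadratic_eq_zero hα (b := β) (c := γ)
      ((IsAlgClosed.exists_pow_nat_eq (discrim α β γ) two_pos).imp fun s hs => by
        rw [← hs, sq])
    exact ⟨1, -t, α, β + α * t, by ring, by ring, by linear_combination ht⟩

theorem linearlyEquivalent_nodal {a b c d : ℂ} (h : NoFactorization fun v =>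
      v 0 * v 1 * v 2 + (a * v 0 ^ 3 + b * v 0 ^ 2 * v 1 + c * v 0 * v 1 ^ 2 + d * v 1 ^ 3)) :
    LinearlyEquivalent
      (fun v =>
        v 0 * v 1 * v 2 + (a * v 0 ^ 3 + b * v 0 ^ 2 * v 1 + c * v 0 * v 1 ^ 2 + d * v 1 ^ 3))
      fun v => v 1 ^ 2 * v 2 - v 0 ^ 2 * (v 0 + v 2) := by
  have ha : a ≠ 0 := by
    rintro rfl
    refine h (X 1) (X 0 * X 2 + C b * X 0 ^ 2 + C c * X 0 * X 1 + C d * X 1 ^ 2) (by simp)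
      (by simp) fun v => ?_
    simp
    ring
  have hd : d ≠ 0 := by
    rintro rfl
    refine h (X 0) (X 1 * X 2 + C a * X 0 ^ 2 + C b * X 0 * X 1 + C c * X 1 ^ 2) (by simp)
      (by simp) fun v => ?_
    simp
    ring
  obtain ⟨l, hl⟩ := IsAlgClosed.exists_pow_nat_eq (8 * a) three_pos
  obtain ⟨m, hm⟩ := IsAlgClosed.exists_pow_nat_eq (-8 * d) three_pos
  have hl0 : l ≠ 0 := by rintro rfl; simp [ha] at hl
  have hm0 : m ≠ 0 := by rintro rfl; simp [hd] at hm
  refine ⟨!![-l / 2, m / 2, 0; l / 2, m / 2, 0;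
    b / (l * m) + 3 * l / 8, c / (l * m) - 3 * m / 8, 1 / (l * m)], ?_, fun v => ?_⟩
  · have : (-1 / 2 : ℂ) ≠ 0 := by norm_num
    convert this using 1
    simp [Matrix.det_fin_three]
    field_simp
    ring
  · simp [Matrix.mulVec, dotProduct, Fin.sum_univ_three]
    field_simp
    linear_combination (-8 * l * m * v 0 ^ 3) * hl + (8 * l * m * v 1 ^ 3) * hm

theorem linearlyEquivalent_cuspidal {a b c d : ℂ} (h : NoFactorization fun v =>
      v 1 ^ 2 * v 2 + (a * v 0 ^ 3 + b * v 0 ^ 2 * v 1 + c * v 0 * v 1 ^ 2 + d * v 1 ^ 3)) :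
    LinearlyEquivalent
      (fun v =>
        v 1 ^ 2 * v 2 + (a * v 0 ^ 3 + b * v 0 ^ 2 * v 1 + c * v 0 * v 1 ^ 2 + d * v 1 ^ 3))
      fun v => v 1 ^ 2 * v 2 - v 0 ^ 3 := by
  have ha : a ≠ 0 := by
    rintro rfl
    refine h (X 1) (X 1 * X 2 + C b * X 0 ^ 2 + C c * X 0 * X 1 + C d * X 1 ^ 2) (by simp)
      (by simp) fun v => ?_
    simp
    ring
  obtain ⟨l, hl⟩ := IsAlgClosed.exists_pow_nat_eq (-a) three_pos
  have hl0 : l ≠ 0 := by rintro rfl; simp [ha] at hl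
  obtain ⟨e, rfl⟩ : ∃ e, b = 3 * a * e := ⟨b / (3 * a), by field_simp⟩
  refine ⟨!![l, l * e, 0; 0, 1, 0; c - 3 * a * e ^ 2, d - a * e ^ 3, 1], ?_, fun v => ?_⟩
  · simpa [Matrix.det_fin_three] using hl0
  · simp [Matrix.mulVec, dotProduct, Fin.sum_univ_three]
    linear_combination (v 0 + e * v 1) ^ 3 * hl

theorem exists_linearlyEquivalent_of_tangents_ne (a b c d : ℂ) {p q r s : ℂ}
    (hD : p * s - q * r ≠ 0) :
    ∃ a' b' c' d' : ℂ, LinearlyEquivalent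
      (fun v => v 2 * ((p * v 0 + q * v 1) * (r * v 0 + s * v 1)) +
        (a * v 0 ^ 3 + b * v 0 ^ 2 * v 1 + c * v 0 * v 1 ^ 2 + d * v 1 ^ 3))
      fun v => v 0 * v 1 * v 2 +
        (a' * v 0 ^ 3 + b' * v 0 ^ 2 * v 1 + c' * v 0 * v 1 ^ 2 + d' * v 1 ^ 3) := by
  obtain ⟨k, hk⟩ : ∃ k, k * (p * s - q * r) ^ 2 = 1 :=
    ⟨((p * s - q * r) ^ 2)⁻¹, inv_mul_cancel₀ (pow_ne_zero 2 hD)⟩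
  have hk0 : k ≠ 0 := left_ne_zero_of_mul_eq_one hk
  refine ⟨a * s ^ 3 - b * s ^ 2 * r + c * s * r ^ 2 - d * r ^ 3,
    -3 * a * s ^ 2 * q + b * (s ^ 2 * p + 2 * s * q * r) - c * (2 * s * r * p + q * r ^ 2) +
      3 * d * r ^ 2 * p,
    3 * a * s * q ^ 2 - b * (2 * s * q * p + q ^ 2 * r) + c * (s * p ^ 2 + 2 * q * r * p) -
      3 * d * r * p ^ 2,
    -a * q ^ 3 + b * q ^ 2 * p - c * q * p ^ 2 + d * p ^ 3,
    LinearlyEquivalent.symm ⟨!![s, -q, 0; -r, p, 0; 0, 0, k], ?_,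
      fun v => ?_⟩⟩
  · convert mul_ne_zero hD hk0 using 1
    simp [Matrix.det_fin_three]
    ring
  · simp [Matrix.mulVec, dotProduct, Fin.sum_univ_three]
    linear_combination (-(v 0 * v 1 * v 2)) * hk

theorem exists_linearlyEquivalent_of_tangents_eq (a b c d : ℂ) {p q : ℂ} (hpq : p ≠ 0 ∨ q ≠ 0) :
    ∃ a' b' c' d' : ℂ, LinearlyEquivalent
      (fun v => v 2 * (p * v 0 + q * v 1) ^ 2 +
        (a * v 0 ^ 3 + b * v 0 ^ 2 * v 1 + c * v 0 * v 1 ^ 2 + d * v 1 ^ 3))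
      fun v => v 1 ^ 2 * v 2 +
        (a' * v 0 ^ 3 + b' * v 0 ^ 2 * v 1 + c' * v 0 * v 1 ^ 2 + d' * v 1 ^ 3) := by
  rcases hpq with hp | hq
  · obtain ⟨q, rfl⟩ : ∃ e, q = p * e := ⟨q / p, by field_simp⟩
    obtain ⟨k, rfl⟩ : ∃ k, p = k⁻¹ := ⟨p⁻¹, by simp⟩
    have hk : k ≠ 0 := by simpa using hp
    refine ⟨-a * q ^ 3 + b * q ^ 2 - c * q + d, k * (3 * a * q ^ 2 - 2 * b * q + c),
      k ^ 2 * (-3 * a * q + b), k ^ 3 * a,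
      LinearlyEquivalent.symm ⟨!![-q, k, 0; 1, 0, 0; 0, 0, 1], ?_, fun v => ?_⟩⟩
    · simpa [Matrix.det_fin_three] using hk
    · simp [Matrix.mulVec, dotProduct, Fin.sum_univ_three]
      field_simp
      ring
  · obtain ⟨p, rfl⟩ : ∃ e, p = q * e := ⟨p / q, by field_simp⟩
    obtain ⟨k, rfl⟩ : ∃ k, q = k⁻¹ := ⟨q⁻¹, by simp⟩
    have hk : k ≠ 0 := by simpa using hq
    refine ⟨a - b * p + c * p ^ 2 - d * p ^ 3, k * (b - 2 * c * p + 3 * d * p ^ 2),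
      k ^ 2 * (c - 3 * d * p), k ^ 3 * d,
      LinearlyEquivalent.symm ⟨!![1, 0, 0; -p, k, 0; 0, 0, 1], ?_, fun v => ?_⟩⟩
    · simpa [Matrix.det_fin_three] using hk
    · simp [Matrix.mulVec, dotProduct, Fin.sum_univ_three]
      field_simp
      ring

theorem linearlyEquivalent_cuspidal_or_nodal {a b c d α β γ : ℂ} (h : NoFactorization fun v =>
      v 2 * (α * v 0 ^ 2 + β * v 0 * v 1 + γ * v 1 ^ 2) +
        (a * v 0 ^ 3 + b * v 0 ^ 2 * v 1 + c * v 0 * v 1 ^ 2 + d * v 1 ^ 3)) :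
    LinearlyEquivalent (fun v => v 2 * (α * v 0 ^ 2 + β * v 0 * v 1 + γ * v 1 ^ 2) +
        (a * v 0 ^ 3 + b * v 0 ^ 2 * v 1 + c * v 0 * v 1 ^ 2 + d * v 1 ^ 3))
      (fun v => v 1 ^ 2 * v 2 - v 0 ^ 3) ∨
    LinearlyEquivalent (fun v => v 2 * (α * v 0 ^ 2 + β * v 0 * v 1 + γ * v 1 ^ 2) +
        (a * v 0 ^ 3 + b * v 0 ^ 2 * v 1 + c * v 0 * v 1 ^ 2 + d * v 1 ^ 3))
      (fun v => v 1 ^ 2 * v 2 - v 0 ^ 2 * (v 0 + v 2)) := by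
  obtain ⟨p, q, r, s, rfl, rfl, rfl⟩ := exists_binary_quadratic_factorization α β γ
  by_cases hD : p * s - q * r = 0
  · left
    have hsq : ∃ p' q' : ℂ, p * r = p' ^ 2 ∧ p * s + q * r = 2 * p' * q' ∧ q * s = q' ^ 2 := by
      obtain ⟨p', hp'⟩ := IsAlgClosed.exists_pow_nat_eq (p * r) two_pos
      by_cases hp0 : p' = 0
      · obtain ⟨q', hq'⟩ := IsAlgClosed.exists_pow_nat_eq (q * s) two_pos
        refine ⟨p', q', hp'.symm, ?_, hq'.symm⟩
        have hpr : p * r = 0 := by rw [← hp', hp0]; ring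
        have : (p * s + q * r) ^ 2 = 0 := by
          linear_combination (p * s - q * r) * hD + 4 * q * s * hpr
        rw [hp0, pow_eq_zero_iff two_ne_zero |>.1 this]
        ring
      · refine ⟨p', (p * s + q * r) / (2 * p'), hp'.symm, by field_simp, ?_⟩
        field_simp
        linear_combination 4 * q * s * hp' - (p * s - q * r) * hD
    obtain ⟨p', q', h1, h2, h3⟩ := hsq
    have hpq : p' ≠ 0 ∨ q' ≠ 0 := by
      by_contra! h0
      refine not_noFactorization_binary_cubic a b c d ?_
      simpa [h1, h2, h3, h0.1, h0.2] using h
    obtain ⟨a', b', c', d', he⟩ := exists_linearlyEquivalent_of_tangents_eq a b c d hpq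
    rw [h1, h2, h3] at h ⊢
    have heq : (fun v : Fin 3 → ℂ =>
        v 2 * (p' ^ 2 * v 0 ^ 2 + 2 * p' * q' * v 0 * v 1 + q' ^ 2 * v 1 ^ 2) +
          (a * v 0 ^ 3 + b * v 0 ^ 2 * v 1 + c * v 0 * v 1 ^ 2 + d * v 1 ^ 3)) =
        fun v => v 2 * (p' * v 0 + q' * v 1) ^ 2 +
          (a * v 0 ^ 3 + b * v 0 ^ 2 * v 1 + c * v 0 * v 1 ^ 2 + d * v 1 ^ 3) := by
      funext v
      ring
    rw [heq] at h ⊢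
    exact he.trans (linearlyEquivalent_cuspidal (h.of_linearlyEquivalent he))
  · right
    obtain ⟨a', b', c', d', he⟩ := exists_linearlyEquivalent_of_tangents_ne a b c d hD
    have heq : (fun v : Fin 3 → ℂ =>
        v 2 * (p * r * v 0 ^ 2 + (p * s + q * r) * v 0 * v 1 + q * s * v 1 ^ 2) +
          (a * v 0 ^ 3 + b * v 0 ^ 2 * v 1 + c * v 0 * v 1 ^ 2 + d * v 1 ^ 3)) =
        fun v => v 2 * ((p * v 0 + q * v 1) * (r * v 0 + s * v 1)) +
          (a * v 0 ^ 3 + b * v 0 ^ 2 * v 1 + c * v 0 * v 1 ^ 2 + d * v 1 ^ 3) := by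
      funext v
      ring
    rw [heq] at h ⊢
    exact he.trans (linearlyEquivalent_nodal (h.of_linearlyEquivalent he))

theorem cubic_coeffs_eq_zero {c₀ c₁ c₂ c₃ : ℂ}
    (h : ∀ t : ℂ, c₀ + c₁ * t + c₂ * t ^ 2 + c₃ * t ^ 3 = 0) : c₁ = 0 ∧ c₂ = 0 := by
  have h0 := h 0
  have h1 := h 1
  have h2 := h (-1)
  have h3 := h 2
  constructor
  · linear_combination (-1 / 2) * h0 + h1 - (1 / 3) * h2 - (1 / 6) * h3
  · linear_combination (1 / 2) * h1 + (1 / 2) * h2 - h0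

theorem not_linearlyEquivalent_cuspidal_nodal :
    ¬ LinearlyEquivalent (fun v => v 1 ^ 2 * v 2 - v 0 ^ 3)
      fun v => v 1 ^ 2 * v 2 - v 0 ^ 2 * (v 0 + v 2) := by
  rintro ⟨A, hA, h⟩
  have key (x y z : ℂ) := h ![x, y, z]
  simp only [Matrix.mulVec, dotProduct, Fin.sum_univ_three, Matrix.cons_val_zero,
    Matrix.cons_val_one, Matrix.cons_val] at key
  rw [Matrix.det_fin_three] at hA
  generalize A 0 0 = a₀ at *
  generalize A 1 0 = a₁ at *
  generalize A 2 0 = a₂ at *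
  generalize A 0 1 = b₀ at *
  generalize A 1 1 = b₁ at *
  generalize A 2 1 = b₂ at *
  generalize A 0 2 = c₀ at *
  generalize A 1 2 = c₁ at *
  generalize A 2 2 = c₂ at *
  -- Expand the nodal cubic around the image of the cusp in the direction `(x, y, 0)`.
  have expand (x y : ℂ) :
      (-3 * c₀ ^ 2 - 2 * c₀ * c₂) * (a₀ * x + b₀ * y) + 2 * c₁ * c₂ * (a₁ * x + b₁ * y) +
          (c₁ ^ 2 - c₀ ^ 2) * (a₂ * x + b₂ * y) = 0 ∧
        c₂ * ((a₁ * x + b₁ * y) ^ 2 - (a₀ * x + b₀ * y) ^ 2) +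
          2 * (c₁ * (a₁ * x + b₁ * y) - c₀ * (a₀ * x + b₀ * y)) * (a₂ * x + b₂ * y) -
          3 * c₀ * (a₀ * x + b₀ * y) ^ 2 - y ^ 2 = 0 := by
    apply cubic_coeffs_eq_zero (c₀ := c₁ ^ 2 * c₂ - c₀ ^ 2 * (c₀ + c₂))
      (c₃ := (a₁ * x + b₁ * y) ^ 2 * (a₂ * x + b₂ * y) -
        (a₀ * x + b₀ * y) ^ 2 * (a₀ * x + b₀ * y + (a₂ * x + b₂ * y)) + x ^ 3)
    intro t
    linear_combination -key (t * x) (t * y) 1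
  have hc := key 0 0 1
  obtain ⟨ha, haa⟩ := expand 1 0
  obtain ⟨hb, hbb⟩ := expand 0 1
  have hab := (expand 1 1).2
  have hg0 : -3 * c₀ ^ 2 - 2 * c₀ * c₂ = 0 := by
    refine (mul_eq_zero.1 ?_).resolve_right hA
    linear_combination (b₁ * c₂ - c₁ * b₂) * ha - (a₁ * c₂ - c₁ * a₂) * hb -
      3 * (a₁ * b₂ - b₁ * a₂) * hc
  have hg1 : c₁ * c₂ = 0 := by
    refine (mul_eq_zero.1 ?_).resolve_right hA
    linear_combination (-(b₀ * c₂ - c₀ * b₂) * ha + (a₀ * c₂ - c₀ * a₂) * hb +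
      3 * (a₀ * b₂ - b₀ * a₂) * hc) / 2
  have hg2 : c₁ ^ 2 - c₀ ^ 2 = 0 := by
    refine (mul_eq_zero.1 ?_).resolve_right hA
    linear_combination (b₀ * c₁ - c₀ * b₁) * ha - (a₀ * c₁ - c₀ * a₁) * hb -
      3 * (a₀ * b₁ - b₀ * a₁) * hc
  have hc₀ : c₀ = 0 := by
    have : c₀ ^ 4 = 0 := by
      rcases mul_eq_zero.1 hg1 with h1 | h2
      · rw [h1] at hg2
        linear_combination -c₀ ^ 2 * hg2
      · rw [h2] at hg0
        linear_combination (-c₀ ^ 2 / 3) * hg0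
    exact (pow_eq_zero_iff (by norm_num)).1 this
  have hc₁ : c₁ = 0 := by
    rw [hc₀] at hg2
    exact (pow_eq_zero_iff two_ne_zero).1 (by linear_combination hg2)
  subst hc₀ hc₁
  have hc₂ : c₂ ≠ 0 := by rintro rfl; simp at hA
  have hdet : a₀ * b₁ - b₀ * a₁ ≠ 0 := fun h0 => hA (by linear_combination c₂ * h0)
  have hdiff : a₁ ^ 2 - a₀ ^ 2 = 0 :=
    (mul_eq_zero.1 (by linear_combination haa)).resolve_left hc₂
  have hprod : a₁ * b₁ - a₀ * b₀ = 0 :=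
    (mul_eq_zero.1 (by linear_combination (hab - haa - hbb) / 2)).resolve_left hc₂
  refine hdet ((pow_eq_zero_iff two_ne_zero).1 ?_)
  linear_combination (b₀ ^ 2 - b₁ ^ 2) * hdiff + (a₁ * b₁ - a₀ * b₀) * hprod

/-- Every irreducible ternary cubic over `ℂ` whose projective plane curve has a
singular point is linearly equivalent to exactly one of the normal forms
`y²z = x³` (cuspidal) and `y²z = x²(x+z)` (nodal). -/
theorem stmt17 (F : MvPolynomial (Fin 3) ℂ) (hhom : F.IsHomogeneous 3)
    (hirr : Irreducible F)
    (hsing : ∃ v : Fin 3 → ℂ, v ≠ 0 ∧ eval v F = 0 ∧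
      ∀ i : Fin 3, eval v (pderiv i F) = 0) :
    let G₁ : MvPolynomial (Fin 3) ℂ := X 1 ^ 2 * X 2 - X 0 ^ 3
    let G₂ : MvPolynomial (Fin 3) ℂ := X 1 ^ 2 * X 2 - X 0 ^ 2 * (X 0 + X 2)
    let LinEquiv : MvPolynomial (Fin 3) ℂ → MvPolynomial (Fin 3) ℂ → Prop :=
      fun P Q => ∃ A : Matrix (Fin 3) (Fin 3) ℂ, A.det ≠ 0 ∧
        ∀ v : Fin 3 → ℂ, eval v P = eval (A.mulVec v) Q
    Xor' (LinEquiv F G₁) (LinEquiv F G₂) := by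
  intro G₁ G₂ LinEquiv
  have h₁ : LinEquiv F G₁ ↔ LinearlyEquivalent (fun v => eval v F)
      fun v => v 1 ^ 2 * v 2 - v 0 ^ 3 := by
    simp [LinEquiv, LinearlyEquivalent, G₁]
  have h₂ : LinEquiv F G₂ ↔ LinearlyEquivalent (fun v => eval v F)
      fun v => v 1 ^ 2 * v 2 - v 0 ^ 2 * (v 0 + v 2) := by
    simp [LinEquiv, LinearlyEquivalent, G₂]
  rw [h₁, h₂]
  obtain ⟨a, b, c, d, α, β, γ, he⟩ := exists_linearlyEquivalent_of_singular hhom hsing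
  rcases linearlyEquivalent_cuspidal_or_nodal
    (hirr.noFactorization.of_linearlyEquivalent he) with h | h
  · exact Or.inl ⟨he.trans h, fun h' =>
      not_linearlyEquivalent_cuspidal_nodal ((he.trans h).symm.trans h')⟩
  · exact Or.inr ⟨he.trans h, fun h' =>
      not_linearlyEquivalent_cuspidal_nodal (h'.symm.trans (he.trans h))⟩
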